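/- For 0 < |q| < 1: ∑_{n=0}^{∞} (−q; q²)_n (q^{2n} − 1) q^{3n² − 2n} / (q²; q²)_{2n} = [(−q; q²)_∞ / (q²; q²)_∞] · [ (−q^{13}, −q^{17}, q^{30}; q^{30})_∞ − (−q^{11}, −q^{19}, q^{30}; q^{30})_∞ − q(−q^{7}, −q^{23}, q^{30}; q^{30})_∞ + q³(−q, −q^{29}, q^{30}; q^{30})_∞ ]. -/

import Mathlib

noncomputable def qp (q x : ℂ) (n : ℕ) : ℂ := ∏ i ∈ Finset.range n, (1 - x * q ^ i)

noncomputable def qpInf (q x : ℂ) : ℂ := ∏' i : ℕ, (1 - x * q ^ i)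

noncomputable def tp (Q a b : ℂ) : ℂ := qpInf Q a * qpInf Q b * qpInf Q Q


open Filter Topology

lemma qp_mult (p x : ℂ) (hp : ‖p‖ < 1) : Summable (fun i : ℕ => ‖-(x * p ^ i)‖) := by
  have := (summable_geometric_of_lt_one (norm_nonneg p) hp).mul_left ‖x‖
  simpa [norm_mul, norm_pow] using this

lemma qp_tendsto (p x : ℂ) (hp : ‖p‖ < 1) :
    Tendsto (fun n => qp p x n) atTop (𝓝 (qpInf p x)) := by
  have h := multipliable_one_add_of_summable (f := fun i : ℕ => -(x * p ^ i)) (qp_mult p x hp)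
  have h2 := h.hasProd.tendsto_prod_nat
  simpa [qp, qpInf, sub_eq_add_neg] using h2

lemma one_sub_pow_ne (p : ℂ) (hp : ‖p‖ < 1) (i : ℕ) : 1 - p * p ^ i ≠ 0 := by
  intro h
  have h1 : p ^ (i + 1) = 1 := by rw [pow_succ']; linear_combination -h
  have h2 : ‖p‖ ^ (i + 1) = 1 := by rw [← norm_pow, h1]; simp
  have h3 := pow_lt_one₀ (norm_nonneg p) hp (Nat.succ_ne_zero i)
  simp only [Nat.succ_eq_add_one] at h3
  linarith

lemma qp_ne (p : ℂ) (hp : ‖p‖ < 1) (n : ℕ) : qp p p n ≠ 0 :=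
  Finset.prod_ne_zero_iff.2 fun i _ => one_sub_pow_ne p hp i

lemma qpInf_ne (p : ℂ) (hp : ‖p‖ < 1) : qpInf p p ≠ 0 := by
  have := tprod_one_add_ne_zero_of_summable (f := fun i : ℕ => -(p * p ^ i))
    (fun i => by simpa [sub_eq_add_neg] using one_sub_pow_ne p hp i) (qp_mult p p hp)
  simpa [qpInf, sub_eq_add_neg] using this

lemma qp_bdd (p x : ℂ) (hp : ‖p‖ < 1) : ∃ M : ℝ, 0 < M ∧ ∀ n, ‖qp p x n‖ ≤ M := by
  obtain ⟨M, hM⟩ := (qp_tendsto p x hp).norm.bddAbove_range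
  refine ⟨max M 1, by positivity, fun n => le_max_of_le_left (hM ⟨n, rfl⟩)⟩

noncomputable def hh (p : ℂ) (k : ℤ) : ℂ := if k < 0 then 0 else (qp p p k.toNat)⁻¹

lemma hh_neg (p : ℂ) {k : ℤ} (hk : k < 0) : hh p k = 0 := by simp [hh, hk]

lemma hh_nat (p : ℂ) (k : ℕ) : hh p k = (qp p p k)⁻¹ := by simp [hh]

lemma hh_rec (p : ℂ) (hp : ‖p‖ < 1) (k : ℤ) : hh p (k - 1) = (1 - p ^ k) * hh p k := by
  rcases lt_trichotomy k 0 with h | h | h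
  · rw [hh_neg p h, hh_neg p (by omega)]; simp
  · subst h; rw [hh_neg p (by omega)]; simp
  · obtain ⟨m, rfl⟩ : ∃ m : ℕ, k = m + 1 := ⟨(k - 1).toNat, by omega⟩
    have e : (m : ℤ) + 1 = ((m + 1 : ℕ) : ℤ) := by push_cast; ring
    rw [add_sub_cancel_right, e, hh_nat, hh_nat, zpow_natCast]
    have h1 := qp_ne p hp m
    have h2 := one_sub_pow_ne p hp m
    have : qp p p (m + 1) = qp p p m * (1 - p * p ^ m) := by simp [qp, Finset.prod_range_succ]
    rw [this, pow_succ']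
    field_simp

lemma hh_tendsto (p : ℂ) (hp : ‖p‖ < 1) :
    Tendsto (fun n : ℕ => hh p n) atTop (𝓝 (qpInf p p)⁻¹) := by
  simp only [hh_nat]
  exact (qp_tendsto p p hp).inv₀ (qpInf_ne p hp)

lemma hh_tendsto' (p : ℂ) (hp : ‖p‖ < 1) :
    Tendsto (fun n : ℤ => hh p n) atTop (𝓝 (qpInf p p)⁻¹) := by
  have h1 := (qp_tendsto p p hp).inv₀ (qpInf_ne p hp)
  have h2 : Tendsto Int.toNat atTop atTop := by
    refine tendsto_atTop.2 fun b => ?_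
    filter_upwards [eventually_ge_atTop (b : ℤ)] with a ha
    omega
  refine (h1.comp h2).congr' ?_
  filter_upwards [eventually_ge_atTop (0 : ℤ)] with a ha
  simp [hh, not_lt.2 ha]

lemma hh_bdd (p : ℂ) (hp : ‖p‖ < 1) : ∃ M : ℝ, 0 < M ∧ ∀ k, ‖hh p k‖ ≤ M := by
  obtain ⟨M, hM⟩ := (hh_tendsto p hp).norm.bddAbove_range
  refine ⟨max M 1, by positivity, fun k => ?_⟩
  by_cases hk : k < 0
  · rw [hh_neg p hk]; simp
  · obtain ⟨m, rfl⟩ : ∃ m : ℕ, k = m := ⟨k.toNat, by omega⟩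
    exact le_max_of_le_left (hM ⟨m, rfl⟩)

lemma e1 (p : ℂ) (h0 : p ≠ 0) (hp : ‖p‖ < 1) (i j : ℤ) :
    (1 - p ^ (i + j)) * (hh p i * hh p j) = hh p (i - 1) * hh p j + p ^ i * (hh p i * hh p (j - 1)) := by
  rw [hh_rec p hp, hh_rec p hp, zpow_add₀ h0]; ring

lemma e2 (p : ℂ) (h0 : p ≠ 0) (hp : ‖p‖ < 1) (i j : ℤ) :
    (1 - p ^ (i + j)) * (hh p i * hh p j) = hh p i * hh p (j - 1) + p ^ j * (hh p (i - 1) * hh p j) := by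
  rw [hh_rec p hp, hh_rec p hp, zpow_add₀ h0]; ring

lemma fin_summable (p : ℂ) (c : ℤ → ℂ) (a b d : ℤ) (hd : 0 < d) :
    Summable (fun r : ℤ => c r * (hh p (a - d * r) * hh p (b + d * r))) := by
  apply summable_of_ne_finset_zero (s := Finset.Icc (-|b|) |a|)
  intro r hr
  simp only [Finset.mem_Icc, not_and_or, not_le] at hr
  rcases hr with h | h
  · have : b + d * r < 0 := by nlinarith [le_abs_self b, abs_nonneg b]
    rw [hh_neg p this]; simp
  · have : a - d * r < 0 := by nlinarith [le_abs_self a, abs_nonneg a]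
    rw [hh_neg p this]; simp

lemma tsum_shift (X Y : ℤ → ℂ) (hX : Summable X) (hY : Summable Y) :
    ∑' r, (X r - Y (r + 1)) = ∑' r, (X r - Y r) := by
  have h := (Equiv.addRight (1 : ℤ)).tsum_eq Y
  have hs : Summable (fun r => Y (r + 1)) := (Equiv.addRight (1 : ℤ)).summable_iff.2 hY
  simp only [Equiv.coe_addRight] at h
  rw [hX.tsum_sub hs, hX.tsum_sub hY, h]

noncomputable def Ss (p : ℂ) (n : ℤ) : ℂ := ∑' r : ℤ, p ^ (3 * r ^ 2 + r) *
  (hh p (n - 3 * r) * hh p (n + 3 * r) - hh p (n - 3 * r - 1) * hh p (n + 3 * r + 1))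

noncomputable def Cs (p : ℂ) (n : ℤ) : ℂ := ∑' r : ℤ, (p ^ (3 * r ^ 2 - 2 * r) *
  (hh p (n - 3 * r) * hh p (n - 1 + 3 * r)) -
  p ^ (3 * r ^ 2 - 2 * r) * (hh p (n + 1 - 3 * r) * hh p (n - 2 + 3 * r)))

noncomputable def Ts (p : ℂ) (n : ℤ) : ℂ := ∑' r : ℤ, p ^ (3 * r ^ 2 - 2 * r) *
  (hh p (n - 3 * r) * hh p (n + 3 * r) - hh p (n - 3 * r + 2) * hh p (n + 3 * r - 2))

lemma S_C (p : ℂ) (h0 : p ≠ 0) (hp : ‖p‖ < 1) (n : ℤ) :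
    (1 - p ^ (2 * n)) * Ss p n = p ^ n * Cs p n := by
  rw [Cs, ← tsum_shift _ _ (fin_summable p _ n (n - 1) 3 (by norm_num))
    (fin_summable p _ (n + 1) (n - 2) 3 (by norm_num)), Ss, ← tsum_mul_left, ← tsum_mul_left]
  congr 1; funext r
  have a1 := e1 p h0 hp (n - 3 * r) (n + 3 * r)
  have a2 := e2 p h0 hp (n - 3 * r - 1) (n + 3 * r + 1)
  rw [show n - 3 * r + (n + 3 * r) = 2 * n by ring] at a1
  rw [show n - 3 * r - 1 + (n + 3 * r + 1) = 2 * n by ring,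
    show n + 3 * r + 1 - 1 = n + 3 * r by ring] at a2
  rw [show n - 1 + 3 * r = n + 3 * r - 1 by ring, show n + 1 - 3 * (r + 1) = n - 3 * r - 1 - 1 by ring,
    show n - 2 + 3 * (r + 1) = n + 3 * r + 1 by ring]
  have b1 : p ^ (3 * r ^ 2 + r) * p ^ (n - 3 * r) = p ^ n * p ^ (3 * r ^ 2 - 2 * r) := by
    rw [← zpow_add₀ h0, ← zpow_add₀ h0]; congr 1; ring
  have b2 : p ^ (3 * r ^ 2 + r) * p ^ (n + 3 * r + 1) =
      p ^ n * p ^ (3 * (r + 1) ^ 2 - 2 * (r + 1)) := by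
    rw [← zpow_add₀ h0, ← zpow_add₀ h0]; congr 1; ring
  linear_combination p ^ (3 * r ^ 2 + r) * (a1 - a2) +
    b1 * (hh p (n - 3 * r) * hh p (n + 3 * r - 1)) -
    b2 * (hh p (n - 3 * r - 1 - 1) * hh p (n + 3 * r + 1))

lemma C_S (p : ℂ) (h0 : p ≠ 0) (hp : ‖p‖ < 1) (n : ℤ) :
    (1 - p ^ (2 * n - 1)) * Cs p n = p ^ (n - 1) * Ss p (n - 1) := by
  have hs : Ss p (n - 1) = ∑' r : ℤ, (p ^ (3 * r ^ 2 + r) *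
      (hh p (n - 1 - 3 * r) * hh p (n - 1 + 3 * r)) - p ^ (3 * r ^ 2 - 5 * r + 2) *
      (hh p (n + 1 - 3 * r) * hh p (n - 3 + 3 * r))) := by
    rw [← tsum_shift _ _ (fin_summable p _ (n - 1) (n - 1) 3 (by norm_num))
      (fin_summable p _ (n + 1) (n - 3) 3 (by norm_num)), Ss]
    congr 1; funext r
    rw [show 3 * (r + 1) ^ 2 - 5 * (r + 1) + 2 = 3 * r ^ 2 + r by ring,
      show n + 1 - 3 * (r + 1) = n - 1 - 3 * r - 1 by ring,
      show n - 3 + 3 * (r + 1) = n - 1 + 3 * r + 1 by ring]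
    ring
  rw [hs, Cs, ← tsum_mul_left, ← tsum_mul_left]
  congr 1; funext r
  have a1 := e2 p h0 hp (n - 3 * r) (n - 1 + 3 * r)
  have a2 := e1 p h0 hp (n + 1 - 3 * r) (n - 2 + 3 * r)
  rw [show n - 3 * r + (n - 1 + 3 * r) = 2 * n - 1 by ring,
    show n - 1 + 3 * r - 1 = n - 2 + 3 * r by ring,
    show n - 3 * r - 1 = n - 1 - 3 * r by ring] at a1
  rw [show n + 1 - 3 * r + (n - 2 + 3 * r) = 2 * n - 1 by ring,
    show n - 2 + 3 * r - 1 = n - 3 + 3 * r by ring,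
    show n + 1 - 3 * r - 1 = n - 3 * r by ring] at a2
  have b1 : p ^ (3 * r ^ 2 - 2 * r) * p ^ (n - 1 + 3 * r) = p ^ (n - 1) * p ^ (3 * r ^ 2 + r) := by
    rw [← zpow_add₀ h0, ← zpow_add₀ h0]; congr 1; ring
  have b2 : p ^ (3 * r ^ 2 - 2 * r) * p ^ (n + 1 - 3 * r) =
      p ^ (n - 1) * p ^ (3 * r ^ 2 - 5 * r + 2) := by
    rw [← zpow_add₀ h0, ← zpow_add₀ h0]; congr 1; ring
  linear_combination p ^ (3 * r ^ 2 - 2 * r) * (a1 - a2) +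
    b1 * (hh p (n - 1 - 3 * r) * hh p (n - 1 + 3 * r)) -
    b2 * (hh p (n + 1 - 3 * r) * hh p (n - 3 + 3 * r))

lemma T_C (p : ℂ) (h0 : p ≠ 0) (hp : ‖p‖ < 1) (n : ℤ) :
    (1 - p ^ (2 * n)) * Ts p n = Cs p n := by
  have sX := fin_summable p (fun r => p ^ n * p ^ (3 * r ^ 2 + r)) (n - 1) n 3 (by norm_num)
  have sY := fin_summable p (fun r => p ^ n * p ^ (3 * r ^ 2 - 5 * r + 2)) (n + 2) (n - 3) 3 (by norm_num)
  have hz : ∑' r : ℤ, (p ^ n * p ^ (3 * r ^ 2 + r) * (hh p (n - 1 - 3 * r) * hh p (n + 3 * r)) -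
      p ^ n * p ^ (3 * r ^ 2 - 5 * r + 2) * (hh p (n + 2 - 3 * r) * hh p (n - 3 + 3 * r))) = 0 := by
    rw [← tsum_shift _ _ sX sY, ← tsum_zero (β := ℤ)]
    congr 1; funext r
    rw [show 3 * (r + 1) ^ 2 - 5 * (r + 1) + 2 = 3 * r ^ 2 + r by ring,
      show n + 2 - 3 * (r + 1) = n - 1 - 3 * r by ring,
      show n - 3 + 3 * (r + 1) = n + 3 * r by ring]
    ring
  rw [← add_zero (Cs p n), ← hz, Cs, ← Summable.tsum_add
    ((fin_summable p _ n (n - 1) 3 (by norm_num)).sub (fin_summable p _ (n + 1) (n - 2) 3 (by norm_num)))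
    (sX.sub sY), Ts, ← tsum_mul_left]
  congr 1; funext r
  have a1 := e2 p h0 hp (n - 3 * r) (n + 3 * r)
  have a2 := e1 p h0 hp (n - 3 * r + 2) (n + 3 * r - 2)
  rw [show n - 3 * r + (n + 3 * r) = 2 * n by ring,
    show n + 3 * r - 1 = n - 1 + 3 * r by ring,
    show n - 3 * r - 1 = n - 1 - 3 * r by ring] at a1
  rw [show n - 3 * r + 2 + (n + 3 * r - 2) = 2 * n by ring,
    show n + 3 * r - 2 - 1 = n - 3 + 3 * r by ring,
    show n - 3 * r + 2 - 1 = n + 1 - 3 * r by ring,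
    show n - 3 * r + 2 = n + 2 - 3 * r by ring,
    show n + 3 * r - 2 = n - 2 + 3 * r by ring] at a2
  rw [show n - 3 * r + 2 = n + 2 - 3 * r by ring,
    show n + 3 * r - 2 = n - 2 + 3 * r by ring]
  have b1 : p ^ (3 * r ^ 2 - 2 * r) * p ^ (n + 3 * r) = p ^ n * p ^ (3 * r ^ 2 + r) := by
    rw [← zpow_add₀ h0, ← zpow_add₀ h0]; congr 1; ring
  have b2 : p ^ (3 * r ^ 2 - 2 * r) * p ^ (n + 2 - 3 * r) =
      p ^ n * p ^ (3 * r ^ 2 - 5 * r + 2) := by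
    rw [← zpow_add₀ h0, ← zpow_add₀ h0]; congr 1; ring
  linear_combination p ^ (3 * r ^ 2 - 2 * r) * (a1 - a2) +
    b1 * (hh p (n - 1 - 3 * r) * hh p (n + 3 * r)) -
    b2 * (hh p (n + 2 - 3 * r) * hh p (n - 3 + 3 * r))

lemma qp_succ (p x : ℂ) (n : ℕ) : qp p x (n + 1) = qp p x n * (1 - x * p ^ n) := by
  simp [qp, Finset.prod_range_succ]

lemma S_zero (p : ℂ) : Ss p 0 = 1 := by
  rw [Ss, tsum_eq_single 0]
  · have : hh p (0 - 3 * 0 - 1) = 0 := hh_neg p (by norm_num)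
    rw [this]; simp [hh, qp]
  · intro r hr
    rcases lt_or_gt_of_ne hr with h | h
    · rw [hh_neg p (k := 0 + 3 * r) (by omega), hh_neg p (k := 0 + 3 * r + 1) (by omega)]; simp
    · rw [hh_neg p (k := 0 - 3 * r) (by omega), hh_neg p (k := 0 - 3 * r - 1) (by omega)]; simp

lemma T_zero (p : ℂ) : Ts p 0 = 1 := by
  rw [Ts, tsum_eq_single 0]
  · have : hh p (0 + 3 * 0 - 2) = 0 := hh_neg p (by norm_num)
    rw [this]; simp [hh, qp]
  · intro r hr
    rcases lt_or_gt_of_ne hr with h | h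
    · rw [hh_neg p (k := 0 + 3 * r) (by omega), hh_neg p (k := 0 + 3 * r - 2) (by omega)]; simp
    · rw [hh_neg p (k := 0 - 3 * r) (by omega), hh_neg p (k := 0 - 3 * r + 2) (by omega)]; simp

lemma one_sub_pow_ne' (p : ℂ) (hp : ‖p‖ < 1) (i : ℕ) : 1 - p ^ (i + 1) ≠ 0 := by
  rw [pow_succ']; exact one_sub_pow_ne p hp i

lemma S_eq (p : ℂ) (h0 : p ≠ 0) (hp : ‖p‖ < 1) (n : ℕ) :
    Ss p n = p ^ (n ^ 2) / qp p p (2 * n) := by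
  induction n with
  | zero => simpa [qp] using S_zero p
  | succ m ih =>
    have a1 := S_C p h0 hp ((m + 1 : ℕ) : ℤ)
    have a2 := C_S p h0 hp ((m + 1 : ℕ) : ℤ)
    rw [show 2 * ((m + 1 : ℕ) : ℤ) = ((2 * m + 1 + 1 : ℕ) : ℤ) by push_cast; ring, zpow_natCast,
      zpow_natCast] at a1
    rw [show 2 * ((m + 1 : ℕ) : ℤ) - 1 = ((2 * m + 1 : ℕ) : ℤ) by push_cast; ring,
      show ((m + 1 : ℕ) : ℤ) - 1 = (m : ℤ) by push_cast; ring, zpow_natCast, zpow_natCast, ih] at a2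
    have c1 := one_sub_pow_ne' p hp (2 * m + 1)
    have c2 := one_sub_pow_ne' p hp (2 * m)
    have c3 := qp_ne p hp (2 * m)
    rw [show 2 * (m + 1) = 2 * m + 1 + 1 by ring, qp_succ, qp_succ, ← pow_succ', ← pow_succ',
      eq_div_iff (by positivity)]
    have a2' : (1 - p ^ (2 * m + 1)) * Cs p ((m + 1 : ℕ) : ℤ) * qp p p (2 * m) = p ^ m * p ^ m ^ 2 := by
      rw [a2]; field_simp
    have : p ^ (m + 1) ^ 2 = p ^ (m + 1) * (p ^ m * p ^ m ^ 2) := by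
      rw [← pow_add, ← pow_add]; congr 1; ring
    rw [this, ← a2']
    linear_combination qp p p (2 * m) * (1 - p ^ (2 * m + 1)) * a1

lemma ST_eq (p : ℂ) (h0 : p ≠ 0) (hp : ‖p‖ < 1) (n : ℕ) :
    Ss p n - Ts p n = (p ^ n - 1) * p ^ (n ^ 2 - n) / qp p p (2 * n) := by
  rcases Nat.eq_zero_or_pos n with rfl | hn
  · simp [S_zero, T_zero]
  · have a1 := S_C p h0 hp n
    have a3 := T_C p h0 hp n
    have a4 := S_eq p h0 hp n
    have c1 : (1 : ℂ) - p ^ (2 * (n : ℤ)) ≠ 0 := by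
      obtain ⟨m, rfl⟩ : ∃ m, n = m + 1 := ⟨n - 1, by omega⟩
      have := one_sub_pow_ne' p hp (2 * m + 1)
      convert this using 2
      rw [← zpow_natCast]; congr 1
    have : Ss p n = p ^ n * Ts p n := by
      apply mul_left_cancel₀ c1
      rw [a1, ← a3, zpow_natCast]; ring
    have h2 : Ts p n = p ^ (n ^ 2 - n) / qp p p (2 * n) := by
      apply mul_left_cancel₀ (pow_ne_zero n h0)
      rw [← this, a4, ← mul_div_assoc, ← pow_add]
      congr 2
      have : n ≤ n ^ 2 := by nlinarith
      omega
    rw [this, h2]; ring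

noncomputable def Ps (y z : ℂ) (n : ℤ) : ℂ :=
  ∑' k : ℤ, y ^ (k ^ 2) * z ^ k * (hh (y ^ 2) (n - 1 * k) * hh (y ^ 2) (n + 1 * k))

lemma P_rec (y z : ℂ) (h0 : y ≠ 0) (hy : ‖y ^ 2‖ < 1) (hz : z ≠ 0) (n : ℤ) :
    (1 - (y ^ 2) ^ (2 * n)) * (1 - (y ^ 2) ^ (2 * n - 1)) * Ps y z n =
      (1 + y ^ (2 * n - 1) * z) * (1 + y ^ (2 * n - 1) / z) * Ps y z (n - 1) := by
  have hp0 : y ^ 2 ≠ 0 := pow_ne_zero 2 h0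
  obtain ⟨p, hpdef⟩ : ∃ p, p = y ^ 2 := ⟨_, rfl⟩
  rw [← hpdef] at hp0 hy ⊢
  have hpy : ∀ k : ℤ, p ^ k = y ^ (2 * k) := fun k => by
    rw [hpdef, zpow_mul]; norm_cast
  obtain ⟨X, hX⟩ : ∃ X : ℤ → ℂ, X = fun k => y ^ (k ^ 2) * z ^ k *
    (hh p (n - 1 - 1 * k) * hh p (n - 1 + 1 * k)) := ⟨_, rfl⟩
  have sX : Summable X := hX ▸ fin_summable p _ (n - 1) (n - 1) 1 (by norm_num)
  have t1 := (Equiv.addRight (1 : ℤ)).tsum_eq X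
  have t2 := (Equiv.addRight (-1 : ℤ)).tsum_eq X
  have s1 : Summable (fun r => X (r + 1)) := (Equiv.addRight (1 : ℤ)).summable_iff.2 sX
  have s2 : Summable (fun r => X (r + -1)) := (Equiv.addRight (-1 : ℤ)).summable_iff.2 sX
  simp only [Equiv.coe_addRight] at t1 t2
  have hP : Ps y z (n - 1) = ∑' k, X k := by rw [Ps, ← hpdef, hX]
  have key : (1 + y ^ (2 * n - 1) * z) * (1 + y ^ (2 * n - 1) / z) * Ps y z (n - 1) =
      ∑' k, ((1 + y ^ (2 * n - 1) * y ^ (2 * n - 1)) * X k + (y ^ (2 * n - 1) / z) * X (k + 1) +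
        (y ^ (2 * n - 1) * z) * X (k + -1)) := by
    rw [((sX.mul_left _).add (s1.mul_left _)).tsum_add (s2.mul_left _),
      (sX.mul_left _).tsum_add (s1.mul_left _), tsum_mul_left, tsum_mul_left, tsum_mul_left,
      t1, t2, hP]
    field_simp
    ring
  rw [key, Ps, ← hpdef, ← tsum_mul_left]
  congr 1; funext k
  simp only [hX, one_mul]
  have a1 := e1 p hp0 hy (n - k) (n + k)
  have a2 := e2 p hp0 hy (n - k - 1) (n + k)
  have a3 := e2 p hp0 hy (n - k) (n + k - 1)
  rw [show n - k + (n + k) = 2 * n by ring] at a1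
  rw [show n - k - 1 + (n + k) = 2 * n - 1 by ring] at a2
  rw [show n - k + (n + k - 1) = 2 * n - 1 by ring] at a3
  rw [show n - 1 - k = n - k - 1 by ring, show n - 1 + k = n + k - 1 by ring,
    show n - 1 - (k + 1) = n - k - 1 - 1 by ring, show n - 1 + (k + 1) = n + k by ring,
    show n - 1 - (k + -1) = n - k by ring, show n - 1 + (k + -1) = n + k - 1 - 1 by ring]
  have b1 : p ^ (n - k) * p ^ (n + k - 1) = y ^ (2 * n - 1) * y ^ (2 * n - 1) := by
    rw [hpy, hpy, ← zpow_add₀ h0, ← zpow_add₀ h0]; congr 1; ring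
  have b2 : y ^ (k ^ 2) * z ^ k * p ^ (n + k) = y ^ (2 * n - 1) / z * (y ^ ((k + 1) ^ 2) * z ^ (k + 1)) := by
    rw [hpy, zpow_add_one₀ hz]
    field_simp
    rw [← zpow_add₀ h0, ← zpow_add₀ h0]; congr 1; ring
  have b3 : y ^ (k ^ 2) * z ^ k * p ^ (n - k) = y ^ (2 * n - 1) * z * (y ^ ((k + -1) ^ 2) * z ^ (k + -1)) := by
    rw [hpy, ← sub_eq_add_neg, zpow_sub_one₀ hz]
    field_simp
    rw [← zpow_add₀ h0, ← zpow_add₀ h0]; congr 1; ring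
  linear_combination y ^ (k ^ 2) * z ^ k * ((1 - p ^ (2 * n - 1)) * a1 + a2 + p ^ (n - k) * a3)
    + y ^ (k ^ 2) * z ^ k * (hh p (n - k - 1) * hh p (n + k - 1)) * b1
    + b2 * (hh p (n - k - 1 - 1) * hh p (n + k)) + b3 * (hh p (n - k) * hh p (n + k - 1 - 1))

lemma P_zero (y z : ℂ) : Ps y z 0 = 1 := by
  rw [Ps, tsum_eq_single 0]
  · simp [hh, qp]
  · intro r hr
    rcases lt_or_gt_of_ne hr with h | h
    · rw [hh_neg _ (k := 0 + 1 * r) (by omega)]; simp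
    · rw [hh_neg _ (k := 0 - 1 * r) (by omega)]; simp

lemma P_eq (y z : ℂ) (h0 : y ≠ 0) (hy : ‖y ^ 2‖ < 1) (hz : z ≠ 0) (n : ℕ) :
    qp (y ^ 2) (y ^ 2) (2 * n) * Ps y z n = qp (y ^ 2) (-(y / z)) n * qp (y ^ 2) (-(y * z)) n := by
  induction n with
  | zero => simpa [qp] using P_zero y z
  | succ m ih =>
    have a := P_rec y z h0 hy hz ((m + 1 : ℕ) : ℤ)
    rw [show 2 * ((m + 1 : ℕ) : ℤ) - 1 = ((2 * m + 1 : ℕ) : ℤ) by push_cast; ring,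
      show 2 * ((m + 1 : ℕ) : ℤ) = ((2 * m + 1 + 1 : ℕ) : ℤ) by push_cast; ring,
      show ((m + 1 : ℕ) : ℤ) - 1 = (m : ℤ) by push_cast; ring, zpow_natCast, zpow_natCast,
      zpow_natCast] at a
    rw [show 2 * (m + 1) = 2 * m + 1 + 1 by ring, qp_succ, qp_succ, qp_succ, qp_succ,
      ← pow_succ', ← pow_succ']
    have c : (y ^ 2) ^ m * y = y ^ (2 * m + 1) := by rw [← pow_mul, ← pow_succ]
    have d : 1 - -(y / z) * (y ^ 2) ^ m = 1 + y ^ (2 * m + 1) / z := by rw [← c]; ring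
    have e : 1 - -(y * z) * (y ^ 2) ^ m = 1 + y ^ (2 * m + 1) * z := by rw [← c]; ring
    rw [d, e]
    linear_combination qp (y ^ 2) (y ^ 2) (2 * m) * a +
      (1 + y ^ (2 * m + 1) * z) * (1 + y ^ (2 * m + 1) / z) * ih

/-- Summability of the theta series. -/
lemma theta_summable (y z : ℂ) (h0 : y ≠ 0) (hy : ‖y‖ < 1) (hz : z ≠ 0) :
    Summable (fun k : ℤ => ‖y ^ (k ^ 2) * z ^ k‖) := by
  have main : ∀ w : ℂ, Summable (fun k : ℕ => ‖y ^ (k ^ 2) * w ^ k‖) := by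
    intro w
    have ht : Tendsto (fun k : ℕ => ‖y‖ ^ k * ‖w‖) atTop (𝓝 0) := by
      simpa using (tendsto_pow_atTop_nhds_zero_of_lt_one (norm_nonneg y) hy).mul_const ‖w‖
    have ev : ∀ᶠ k : ℕ in atTop, ‖y‖ ^ k * ‖w‖ ≤ 1 / 2 :=
      (ht.eventually (ge_mem_nhds (by norm_num : (0 : ℝ) < 1 / 2)))
    refine Summable.of_norm_bounded_eventually_nat (g := fun k : ℕ => (1 / 2 : ℝ) ^ k)
      (summable_geometric_of_lt_one (by norm_num) (by norm_num)) ?_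
    filter_upwards [ev] with k hk
    rw [norm_norm, norm_mul, norm_pow, norm_pow, sq, pow_mul, ← mul_pow]
    exact pow_le_pow_left₀ (by positivity) hk k
  apply Summable.of_nat_of_neg
  · refine (main z).congr fun k => ?_
    norm_cast
  · refine (main z⁻¹).congr fun k => ?_
    rw [neg_sq, zpow_neg, inv_pow, zpow_natCast]
    norm_cast

lemma jtp (y z : ℂ) (h0 : y ≠ 0) (hy : ‖y‖ < 1) (hz : z ≠ 0) :
    HasSum (fun k : ℤ => y ^ (k ^ 2) * z ^ k) (tp (y ^ 2) (-(y / z)) (-(y * z))) := by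
  have hy2 : ‖y ^ 2‖ < 1 := by rw [norm_pow]; exact pow_lt_one₀ (norm_nonneg _) hy (by norm_num)
  have hs := theta_summable y z h0 hy hz
  set p := y ^ 2 with hp
  obtain ⟨M, hM, hMb⟩ := hh_bdd p hy2
  have h1 : Tendsto (fun n : ℕ => Ps y z n) atTop
      (𝓝 (∑' k : ℤ, y ^ (k ^ 2) * z ^ k * ((qpInf p p)⁻¹ * (qpInf p p)⁻¹))) := by
    refine tendsto_tsum_of_dominated_convergence (hs.mul_right (M * M)) (fun k => ?_)
      (Eventually.of_forall fun n k => ?_)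
    · refine Tendsto.const_mul _ (Tendsto.mul ?_ ?_)
      · refine (hh_tendsto' p hy2).comp ?_
        simpa [sub_eq_add_neg] using
          tendsto_atTop_add_const_right atTop (-k) (tendsto_natCast_atTop_atTop (R := ℤ))
      · refine (hh_tendsto' p hy2).comp ?_
        simpa using
          tendsto_atTop_add_const_right atTop k (tendsto_natCast_atTop_atTop (R := ℤ))
    · rw [norm_mul, norm_mul (hh _ _)]
      gcongr
      · exact hMb _
      · exact hMb _
  have h2 : Tendsto (fun n : ℕ => qp p p (2 * n) * Ps y z n) atTop
      (𝓝 (qpInf p p * (∑' k : ℤ, y ^ (k ^ 2) * z ^ k * ((qpInf p p)⁻¹ * (qpInf p p)⁻¹)))) := by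
    refine Tendsto.mul ((qp_tendsto p p hy2).comp ?_) h1
    exact tendsto_id.const_mul_atTop' (by norm_num)
  have h3 : Tendsto (fun n : ℕ => qp p p (2 * n) * Ps y z n) atTop
      (𝓝 (qpInf p (-(y / z)) * qpInf p (-(y * z)))) := by
    refine ((qp_tendsto p (-(y / z)) hy2).mul (qp_tendsto p (-(y * z)) hy2)).congr fun n => ?_
    rw [P_eq y z h0 hy2 hz]
  have h4 := tendsto_nhds_unique h2 h3
  rw [tsum_mul_right] at h4
  have hne := qpInf_ne p hy2
  have h5 : ∑' k : ℤ, y ^ (k ^ 2) * z ^ k = tp p (-(y / z)) (-(y * z)) := by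
    rw [tp, ← h4]; field_simp
  rw [← h5]
  exact hs.of_norm.hasSum

noncomputable def ww (q : ℂ) (n : ℕ) (k : ℤ) : ℂ :=
  qp (q ^ 2) (-q) n * q ^ (n ^ 2) * (hh (q ^ 2) (n - k) * hh (q ^ 2) (n + k))

lemma ww_zero (q : ℂ) (n : ℕ) (k : ℤ) (h : n < k.natAbs) : ww q n k = 0 := by
  unfold ww
  by_cases hk : (n : ℤ) - k < 0
  · rw [hh_neg _ hk]; simp
  · rw [hh_neg _ (k := (n : ℤ) + k) (by omega)]; simp

lemma ww_neg (q : ℂ) (n : ℕ) (k : ℤ) : ww q n (-k) = ww q n k := by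
  unfold ww
  rw [sub_neg_eq_add, ← sub_eq_add_neg]; ring

lemma norm_sq_lt (q : ℂ) (h1 : ‖q‖ < 1) : ‖q ^ 2‖ < 1 := by
  rw [norm_pow]; exact pow_lt_one₀ (norm_nonneg _) h1 (by norm_num)

lemma ww_bound (q : ℂ) (h1 : ‖q‖ < 1) :
    ∃ M : ℝ, 0 < M ∧ ∀ n k, ‖ww q n k‖ ≤ M * ‖q‖ ^ (n ^ 2) := by
  have h2 := norm_sq_lt q h1
  obtain ⟨M, hM, hMb⟩ := hh_bdd (q ^ 2) h2
  obtain ⟨A, hA, hAb⟩ := qp_bdd (q ^ 2) (-q) h2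
  refine ⟨A * (M * M), by positivity, fun n k => ?_⟩
  rw [ww, norm_mul, norm_mul, norm_mul (hh _ _), norm_pow,
    show A * (M * M) * ‖q‖ ^ n ^ 2 = A * ‖q‖ ^ n ^ 2 * (M * M) by ring]
  gcongr
  · exact hAb _
  · exact hMb _
  · exact hMb _

lemma ww_summable2 (q : ℂ) (h0 : q ≠ 0) (h1 : ‖q‖ < 1) :
    Summable (fun x : ℕ × ℤ => ‖ww q x.1 x.2‖) := by
  obtain ⟨M, hM, hb⟩ := ww_bound q h1
  have hq : 0 < ‖q‖ := norm_pos_iff.2 h0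
  have g1 := summable_geometric_of_lt_one (norm_nonneg q) h1
  have g2 : Summable (fun k : ℤ => ‖q‖ ^ k.natAbs) := by
    apply Summable.of_nat_of_neg
    · simpa using g1
    · simpa using g1
  have g3 := (g1.mul_of_nonneg g2 (fun _ => by positivity) (fun _ => by positivity)).mul_left (M / ‖q‖)
  refine Summable.of_nonneg_of_le (fun _ => norm_nonneg _) (fun x => ?_) g3
  obtain ⟨n, k⟩ := x
  simp only
  by_cases h : n < k.natAbs
  · rw [ww_zero q n k h, norm_zero]; positivity
  · refine (hb n k).trans ?_
    rw [div_mul_eq_mul_div, le_div_iff₀ hq, mul_assoc]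
    refine mul_le_mul_of_nonneg_left ?_ hM.le
    rw [← pow_add, ← pow_succ]
    apply pow_le_pow_of_le_one hq.le h1.le
    have : n * 2 ≤ n ^ 2 + 1 := by
      zify; nlinarith [sq_nonneg ((n : ℤ) - 1)]
    omega

lemma ww_summable (q : ℂ) (h0 : q ≠ 0) (h1 : ‖q‖ < 1) (k : ℤ) :
    Summable (fun n : ℕ => ww q n k) :=
  ((ww_summable2 q h0 h1).comp_injective (i := fun n : ℕ => (n, k))
    (fun a b h => by simpa using h)).of_norm

lemma U_rec (q : ℂ) (h0 : q ≠ 0) (h1 : ‖q‖ < 1) (r : ℕ) :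
    ∑' n : ℕ, ww q n ((r + 1 : ℕ) : ℤ) = q ^ (2 * r + 1) * ∑' n : ℕ, ww q n r := by
  have h2 := norm_sq_lt q h1
  have hp0 : q ^ 2 ≠ 0 := pow_ne_zero 2 h0
  obtain ⟨M, hM, hMb⟩ := hh_bdd (q ^ 2) h2
  obtain ⟨A, hA, hAb⟩ := qp_bdd (q ^ 2) (-q) h2
  set g : ℕ → ℂ := fun n => -(1 - q ^ (2 * r + 1)) * (qp (q ^ 2) (-q) n * q ^ (n ^ 2) *
    (hh (q ^ 2) (n - r - 1) * hh (q ^ 2) (n + r))) with hg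
  have step : ∀ n : ℕ, ww q n ((r + 1 : ℕ) : ℤ) - q ^ (2 * r + 1) * ww q n r = g (n + 1) - g n := by
    intro n
    simp only [hg, ww, qp_succ]
    push_cast
    rw [show (n : ℤ) - (r + 1) = n - r - 1 by ring, show (n : ℤ) + 1 - r - 1 = n - r by ring,
      show (n : ℤ) + (r + 1) = n + r + 1 by ring, show (n : ℤ) + 1 + r = n + r + 1 by ring]
    have r1 := hh_rec (q ^ 2) h2 (n - r)
    have r2 := hh_rec (q ^ 2) h2 (n + r + 1)
    rw [add_sub_cancel_right] at r2
    rw [r1, r2]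
    have z1 : (q ^ 2) ^ ((n : ℤ) - r) = (q ^ n) ^ 2 / (q ^ r) ^ 2 := by
      rw [zpow_sub₀ hp0, zpow_natCast, zpow_natCast, ← pow_mul, ← pow_mul, ← pow_mul, ← pow_mul]
      congr 2 <;> ring
    have z2 : (q ^ 2) ^ ((n : ℤ) + r + 1) = (q ^ n) ^ 2 * (q ^ r) ^ 2 * q ^ 2 := by
      rw [zpow_add_one₀ hp0, zpow_add₀ hp0, zpow_natCast, zpow_natCast]
      ring
    have z3 : q ^ (2 * r + 1) = (q ^ r) ^ 2 * q := by ring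
    have z4 : q ^ ((n + 1) ^ 2) = q ^ (n ^ 2) * (q ^ n) ^ 2 * q := by ring
    have z5 : (q ^ 2) ^ n = (q ^ n) ^ 2 := by ring
    rw [z1, z2, z3, z4, z5]
    have : q ^ r ≠ 0 := pow_ne_zero _ h0
    field_simp
    ring
  have g0 : g 0 = 0 := by
    simp only [hg]
    rw [hh_neg _ (k := ((0 : ℕ) : ℤ) - r - 1) (by push_cast; omega)]; simp
  have gt : Tendsto g atTop (𝓝 0) := by
    have hb : ∀ n, ‖g n‖ ≤ ‖-(1 - q ^ (2 * r + 1))‖ * (A * (M * M)) * ‖q‖ ^ n := by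
      intro n
      simp only [hg]
      rw [norm_mul, norm_mul (_ * _), norm_mul (qp _ _ _), norm_mul (hh _ _), norm_pow,
        show ‖-(1 - q ^ (2 * r + 1))‖ * (A * (M * M)) * ‖q‖ ^ n =
          ‖-(1 - q ^ (2 * r + 1))‖ * (A * ‖q‖ ^ n * (M * M)) by ring]
      have : ‖q‖ ^ (n ^ 2) ≤ ‖q‖ ^ n :=
        pow_le_pow_of_le_one (norm_nonneg q) h1.le (by nlinarith [Nat.le_self_pow (two_ne_zero) n])
      gcongr
      · exact hAb _
      · exact hMb _
      · exact hMb _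
    refine squeeze_zero_norm hb ?_
    simpa using (tendsto_pow_atTop_nhds_zero_of_lt_one (norm_nonneg q) h1).const_mul
      (‖-(1 - q ^ (2 * r + 1))‖ * (A * (M * M)))
  have sA := ww_summable q h0 h1 ((r + 1 : ℕ) : ℤ)
  have sB := (ww_summable q h0 h1 (r : ℤ)).mul_left (q ^ (2 * r + 1))
  have l1 := (sA.sub sB).hasSum.tendsto_sum_nat
  have l2 : Tendsto (fun N => ∑ n ∈ Finset.range N,
      (ww q n ((r + 1 : ℕ) : ℤ) - q ^ (2 * r + 1) * ww q n r)) atTop (𝓝 0) := by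
    simp only [step, Finset.sum_range_sub, g0, sub_zero]
    exact gt
  have l3 := tendsto_nhds_unique l1 l2
  rw [sA.tsum_sub sB, tsum_mul_left] at l3
  linear_combination l3

lemma U_pow (q : ℂ) (h0 : q ≠ 0) (h1 : ‖q‖ < 1) (r : ℕ) :
    ∑' n : ℕ, ww q n r = q ^ (r ^ 2) * ∑' n : ℕ, ww q n 0 := by
  induction r with
  | zero => simp
  | succ m ih => rw [U_rec q h0 h1, ih]; ring

lemma U_zero (q : ℂ) (h0 : q ≠ 0) (h1 : ‖q‖ < 1) :
    ∑' n : ℕ, ww q n 0 = qpInf (q ^ 2) (-q) / qpInf (q ^ 2) (q ^ 2) := by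
  have h2 := norm_sq_lt q h1
  obtain ⟨M, hM, hMb⟩ := hh_bdd (q ^ 2) h2
  obtain ⟨A, hA, hAb⟩ := qp_bdd (q ^ 2) (-q) h2
  set f : ℕ → ℕ → ℂ := fun r m => qp (q ^ 2) (-q) (m + r) * (q ^ (m ^ 2) * (q ^ m) ^ (2 * r)) *
    (hh (q ^ 2) m * hh (q ^ 2) ((m + 2 * r : ℕ) : ℤ)) with hf
  have hfe : ∀ r : ℕ, ∑' m, f r m = ∑' n : ℕ, ww q n 0 := by
    intro r
    have hq : q ^ (r ^ 2) ≠ 0 := pow_ne_zero _ h0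
    apply mul_left_cancel₀ hq
    rw [← U_pow q h0 h1 r, ← tsum_mul_left]
    have hi : Function.Injective (fun m : ℕ => m + r) := add_left_injective r
    rw [← hi.tsum_eq (f := fun n : ℕ => ww q n r)]
    · congr 1; funext m
      simp only [hf, ww]
      rw [show ((m + r : ℕ) : ℤ) - r = m by push_cast; ring,
        show ((m + r : ℕ) : ℤ) + r = ((m + 2 * r : ℕ) : ℤ) by push_cast; ring]
      ring
    · intro n hn
      by_contra hc
      apply hn
      apply ww_zero
      simp only [Set.mem_range, not_exists] at hc
      by_contra hlt
      exact hc (n - r) (by simp at hlt; omega)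
  have hlim : Tendsto (fun r => ∑' m, f r m) atTop (𝓝 (∑' m : ℕ, if m = 0 then
      qpInf (q ^ 2) (-q) / qpInf (q ^ 2) (q ^ 2) else 0)) := by
    refine tendsto_tsum_of_dominated_convergence (bound := fun m : ℕ => A * (M * M) * ‖q‖ ^ m)
      ((summable_geometric_of_lt_one (norm_nonneg q) h1).mul_left _) (fun m => ?_)
      (Eventually.of_forall fun r m => ?_)
    · have ta : Tendsto (fun r : ℕ => qp (q ^ 2) (-q) (m + r)) atTop (𝓝 (qpInf (q ^ 2) (-q))) := by
        refine (qp_tendsto (q ^ 2) (-q) h2).comp ?_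
        simpa [add_comm] using tendsto_add_atTop_nat m
      have tb : Tendsto (fun r : ℕ => hh (q ^ 2) ((m + 2 * r : ℕ) : ℤ)) atTop
          (𝓝 (qpInf (q ^ 2) (q ^ 2))⁻¹) := by
        refine (hh_tendsto (q ^ 2) h2).comp ?_
        exact tendsto_atTop_mono (fun r => (by simp only [id]; omega)) tendsto_id
      by_cases hm : m = 0
      · subst hm
        have : hh (q ^ 2) 0 = 1 := by simp [hh, qp]
        simpa [hf, this, div_eq_mul_inv] using ta.mul tb
      · have tc : Tendsto (fun r : ℕ => (q ^ m) ^ (2 * r)) atTop (𝓝 0) := by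
          have : ‖(q ^ m) ^ 2‖ < 1 := by
            rw [norm_pow, norm_pow, ← pow_mul]
            exact pow_lt_one₀ (norm_nonneg _) h1 (by omega)
          simpa [pow_mul] using tendsto_pow_atTop_nhds_zero_of_norm_lt_one this
        have := (ta.mul (tc.const_mul (q ^ (m ^ 2)))).mul (tb.const_mul (hh (q ^ 2) m))
        simpa [hf, hm] using this
    · simp only [hf]
      rw [norm_mul, norm_mul (qp _ _ _), norm_mul (q ^ (m ^ 2)), norm_mul (hh _ _), norm_pow, norm_pow,
        norm_pow, show A * (M * M) * ‖q‖ ^ m = A * (‖q‖ ^ m * 1) * (M * M) by ring]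
      have e1 : ‖q‖ ^ (m ^ 2) ≤ ‖q‖ ^ m :=
        pow_le_pow_of_le_one (norm_nonneg q) h1.le (by nlinarith [Nat.le_self_pow (two_ne_zero) m])
      have e2 : (‖q‖ ^ m) ^ (2 * r) ≤ 1 :=
        pow_le_one₀ (by positivity) (pow_le_one₀ (norm_nonneg q) h1.le)
      gcongr
      · exact hAb _
      · exact hMb _
      · exact hMb _
  rw [tsum_ite_eq] at hlim
  simp only [hfe] at hlim
  exact tendsto_nhds_unique tendsto_const_nhds hlim

lemma U_eq (q : ℂ) (h0 : q ≠ 0) (h1 : ‖q‖ < 1) (k : ℤ) :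
    ∑' n : ℕ, ww q n k = qpInf (q ^ 2) (-q) / qpInf (q ^ 2) (q ^ 2) * q ^ (k ^ 2) := by
  have : ∑' n : ℕ, ww q n k = ∑' n : ℕ, ww q n (k.natAbs : ℤ) := by
    rcases Int.natAbs_eq k with h | h
    · rw [← h]
    · congr 1; funext n; conv_lhs => rw [h, ww_neg]
  rw [this, U_pow q h0 h1, U_zero q h0 h1, mul_comm]
  congr 1
  rw [← Int.natAbs_sq k, ← zpow_natCast]; congr 1

lemma ww_summable3 (q : ℂ) (h0 : q ≠ 0) (h1 : ‖q‖ < 1) (c : ℤ → ℂ) (hc : ∀ r, ‖c r‖ ≤ 1) (s : ℤ) :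
    Summable (fun x : ℕ × ℤ => c x.2 * ww q x.1 (3 * x.2 + s)) := by
  have h := (ww_summable2 q h0 h1).comp_injective (i := fun x : ℕ × ℤ => (x.1, 3 * x.2 + s))
    (fun a b h => by
      simp only [Prod.mk.injEq] at h
      ext
      · exact h.1
      · have := h.2; omega)
  refine Summable.of_norm_bounded h fun x => ?_
  rw [norm_mul]
  exact mul_le_of_le_one_left (norm_nonneg _) (hc _)

/-- Interchange of summation for one Bailey component. -/
lemma swap (q : ℂ) (h0 : q ≠ 0) (h1 : ‖q‖ < 1) (c : ℤ → ℂ) (hc : ∀ r, ‖c r‖ ≤ 1) (s : ℤ) :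
    HasSum (fun n : ℕ => ∑' r : ℤ, c r * ww q n (3 * r + s))
      (qpInf (q ^ 2) (-q) / qpInf (q ^ 2) (q ^ 2) * ∑' r : ℤ, c r * q ^ ((3 * r + s) ^ 2)) := by
  have hs := ww_summable3 q h0 h1 c hc s
  have hs' : Summable (Function.uncurry fun (n : ℕ) (r : ℤ) => c r * ww q n (3 * r + s)) := hs
  have e : ∑' n : ℕ, ∑' r : ℤ, c r * ww q n (3 * r + s) =
      qpInf (q ^ 2) (-q) / qpInf (q ^ 2) (q ^ 2) * ∑' r : ℤ, c r * q ^ ((3 * r + s) ^ 2) := by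
    rw [← hs'.tsum_comm, ← tsum_mul_left]
    congr 1; funext r
    rw [tsum_mul_left, U_eq q h0 h1]; ring
  rw [← e]
  exact hs.prod.hasSum

lemma theta15 (q : ℂ) (h0 : q ≠ 0) (h1 : ‖q‖ < 1) (a : ℕ) (ha : a ≤ 15) :
    ∑' r : ℤ, q ^ (15 * r ^ 2 + a * r) = tp (q ^ 30) (-q ^ (15 - a)) (-q ^ (15 + a)) := by
  have h := (jtp (q ^ 15) (q ^ a) (pow_ne_zero _ h0)
    (by rw [norm_pow]; exact pow_lt_one₀ (norm_nonneg _) h1 (by norm_num)) (pow_ne_zero _ h0)).tsum_eq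
  rw [← pow_mul, ← pow_add] at h
  have e : q ^ 15 / q ^ a = q ^ (15 - a) := by
    rw [div_eq_iff (pow_ne_zero _ h0), ← pow_add]; congr 1; omega
  rw [e] at h
  rw [← h]
  congr 1; funext r
  rw [← zpow_natCast, ← zpow_natCast, ← zpow_mul, ← zpow_mul, ← zpow_add₀ h0]
  congr 1

lemma norm_zpow_le (q : ℂ) (h1 : ‖q‖ < 1) (m : ℤ) (hm : 0 ≤ m) : ‖(q ^ 2) ^ m‖ ≤ 1 := by
  lift m to ℕ using hm
  rw [zpow_natCast, norm_pow, norm_pow]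
  exact pow_le_one₀ (by positivity) (pow_le_one₀ (norm_nonneg _) h1.le)

theorem stmt9 (q : ℂ) (h0 : 0 < ‖q‖) (h1 : ‖q‖ < 1) :
    ∑' n : ℕ, qp (q ^ 2) (-q) n * (q ^ (2 * n) - 1) * q ^ (3 * n ^ 2 - 2 * n) /
        qp (q ^ 2) (q ^ 2) (2 * n)
      = (qpInf (q ^ 2) (-q) / qpInf (q ^ 2) (q ^ 2)) *
          (tp (q ^ 30) (-q ^ 13) (-q ^ 17) - tp (q ^ 30) (-q ^ 11) (-q ^ 19)
            - q * tp (q ^ 30) (-q ^ 7) (-q ^ 23) + q ^ 3 * tp (q ^ 30) (-q) (-q ^ 29)) := by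
  have hq : q ≠ 0 := norm_pos_iff.1 h0
  have h2 := norm_sq_lt q h1
  have hp0 : q ^ 2 ≠ 0 := pow_ne_zero 2 hq
  have hpz : ∀ k : ℤ, (q ^ 2) ^ k = q ^ (2 * k) := fun k => by
    rw [zpow_mul]; norm_cast
  have hc1 : ∀ r : ℤ, ‖(q ^ 2) ^ (3 * r ^ 2 + r)‖ ≤ 1 := fun r =>
    norm_zpow_le q h1 _ (by rcases le_or_gt 0 r with h | h <;> nlinarith)
  have hc2 : ∀ r : ℤ, ‖(q ^ 2) ^ (3 * r ^ 2 - 2 * r)‖ ≤ 1 := fun r =>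
    norm_zpow_le q h1 _ (by rcases le_or_gt r 0 with h | h <;> nlinarith)
  have s1 := swap q hq h1 _ hc1 0
  have s2 := swap q hq h1 _ hc1 1
  have s3 := swap q hq h1 _ hc2 0
  have s4 := swap q hq h1 _ hc2 (-2)
  have t1 : ∑' r : ℤ, (q ^ 2) ^ (3 * r ^ 2 + r) * q ^ ((3 * r + 0) ^ 2) =
      tp (q ^ 30) (-q ^ 13) (-q ^ 17) := by
    rw [← theta15 q hq h1 2 (by norm_num)]
    congr 1; funext r
    rw [hpz, ← zpow_add₀ hq]; congr 1; push_cast; ring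
  have t2 : ∑' r : ℤ, (q ^ 2) ^ (3 * r ^ 2 + r) * q ^ ((3 * r + 1) ^ 2) =
      q * tp (q ^ 30) (-q ^ 7) (-q ^ 23) := by
    rw [← theta15 q hq h1 8 (by norm_num), ← tsum_mul_left]
    congr 1; funext r
    rw [hpz, ← zpow_add₀ hq, ← zpow_one_add₀ hq]; congr 1; push_cast; ring
  have t3 : ∑' r : ℤ, (q ^ 2) ^ (3 * r ^ 2 - 2 * r) * q ^ ((3 * r + 0) ^ 2) =
      tp (q ^ 30) (-q ^ 11) (-q ^ 19) := by
    rw [← theta15 q hq h1 4 (by norm_num), ← (Equiv.neg ℤ).tsum_eq]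
    congr 1; funext r
    rw [Equiv.neg_apply, hpz, ← zpow_add₀ hq]; congr 1; push_cast; ring
  have t4 : ∑' r : ℤ, (q ^ 2) ^ (3 * r ^ 2 - 2 * r) * q ^ ((3 * r + -2) ^ 2) =
      q ^ 3 * tp (q ^ 30) (-q) (-q ^ 29) := by
    have := theta15 q hq h1 14 (by norm_num)
    norm_num at this
    rw [← this, ← (Equiv.addRight (1 : ℤ)).tsum_eq, ← tsum_mul_left]
    congr 1; funext r
    rw [Equiv.coe_addRight, hpz, ← zpow_add₀ hq, ← zpow_natCast q 3, ← zpow_add₀ hq]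
    congr 1; push_cast; ring
  rw [t1] at s1
  rw [t2] at s2
  rw [t3] at s3
  rw [t4] at s4
  have H := ((s1.sub s2).sub (s3.sub s4)).tsum_eq
  refine Eq.trans (Eq.trans ?_ H) (by ring)
  congr 1; funext n
  have f1 := (ww_summable3 q hq h1 _ hc1 0).prod_factor n
  have f2 := (ww_summable3 q hq h1 _ hc1 1).prod_factor n
  have f3 := (ww_summable3 q hq h1 _ hc2 0).prod_factor n
  have f4 := (ww_summable3 q hq h1 _ hc2 (-2)).prod_factor n
  have eS : qp (q ^ 2) (-q) n * q ^ (n ^ 2) * Ss (q ^ 2) n =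
      ∑' r : ℤ, (q ^ 2) ^ (3 * r ^ 2 + r) * ww q n (3 * r + 0) -
      ∑' r : ℤ, (q ^ 2) ^ (3 * r ^ 2 + r) * ww q n (3 * r + 1) := by
    rw [← f1.tsum_sub f2, Ss, ← tsum_mul_left]
    congr 1; funext r
    simp only [ww]
    rw [add_zero, show (n : ℤ) - (3 * r + 1) = n - 3 * r - 1 by ring,
      show (n : ℤ) + (3 * r + 1) = n + 3 * r + 1 by ring]
    ring
  have eT : qp (q ^ 2) (-q) n * q ^ (n ^ 2) * Ts (q ^ 2) n =
      ∑' r : ℤ, (q ^ 2) ^ (3 * r ^ 2 - 2 * r) * ww q n (3 * r + 0) -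
      ∑' r : ℤ, (q ^ 2) ^ (3 * r ^ 2 - 2 * r) * ww q n (3 * r + -2) := by
    rw [← f3.tsum_sub f4, Ts, ← tsum_mul_left]
    congr 1; funext r
    simp only [ww]
    rw [add_zero, show (n : ℤ) - (3 * r + -2) = n - 3 * r + 2 by ring,
      show (n : ℤ) + (3 * r + -2) = n + 3 * r - 2 by ring]
    ring
  rw [← eS, ← eT, ← mul_sub, ST_eq (q ^ 2) hp0 h2 n]
  have : q ^ (3 * n ^ 2 - 2 * n) = q ^ (n ^ 2) * (q ^ 2) ^ (n ^ 2 - n) := by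
    rw [← pow_mul, ← pow_add]
    congr 1
    have : n ≤ n ^ 2 := Nat.le_self_pow two_ne_zero n
    omega
  rw [this, pow_mul]
  ring
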